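/- Let F be any field. Let 𝒞 be any set of order-three tensors over F (of arbitrary formats) such that for every T ∈ 𝒞 there is a concise S ∈ 𝒞 that is equivalent to T. Let f : 𝒞 → ℝ_{≥0} be any function such that: (i) f(S) = f(T) whenever S, T ∈ 𝒞 are equivalent; (ii) f(T) ≥ Q~(T) for every T ∈ 𝒞; (iii) for every n1, n2, n3 ∈ ℕ, f takes only finitely many values on 𝒞 ∩ (F^{n1} ⊗ F^{n2} ⊗ F^{n3}); (iv) for every n1, n2, n3 ∈ ℕ and every T ∈ 𝒞 ∩ (F^{n1} ⊗ F^{n2} ⊗ F^{n3}), f(T) ≤ min{n1, n2, n3}. Then the set of values {f(T) : T ∈ 𝒞} ⊆ ℝ has no accumulation points. -/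

import Mathlib

open scoped BigOperators

namespace Paper

variable {F : Type*} [Field F]

/-- Restriction of order-three tensors: `T ≥ S` iff there exist linear maps
(given by matrices `L1, L2, L3`) carrying `T` to `S`. -/
def Restricts {ι1 ι2 ι3 κ1 κ2 κ3 : Type*} [Fintype ι1] [Fintype ι2] [Fintype ι3]
    (T : ι1 → ι2 → ι3 → F) (S : κ1 → κ2 → κ3 → F) : Prop :=
  ∃ (L1 : κ1 → ι1 → F) (L2 : κ2 → ι2 → F) (L3 : κ3 → ι3 → F),
    ∀ a b c, S a b c = ∑ i, ∑ j, ∑ k, L1 a i * L2 b j * L3 c k * T i j k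

/-- The unit (diagonal) tensor `⟨r⟩`. -/
def unitTensor (F : Type*) [Field F] (r : ℕ) : Fin r → Fin r → Fin r → F :=
  fun i j k => if i = j ∧ j = k then 1 else 0

/-- The subrank `Q(T)`: the largest `r` such that `T` restricts to `⟨r⟩`. -/
noncomputable def subrank {ι1 ι2 ι3 : Type*} [Fintype ι1] [Fintype ι2] [Fintype ι3]
    (T : ι1 → ι2 → ι3 → F) : ℕ :=
  sSup {r : ℕ | Restricts T (unitTensor F r)}

/-- Kronecker (tensor) power `T^{⊠ m}` of an order-three tensor. -/
def kronPow {ι1 ι2 ι3 : Type*} (T : ι1 → ι2 → ι3 → F) (m : ℕ) :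
    (Fin m → ι1) → (Fin m → ι2) → (Fin m → ι3) → F :=
  fun x y z => ∏ s : Fin m, T (x s) (y s) (z s)

/-- Asymptotic subrank `Q~(T) = lim_n Q(T^{⊠n})^{1/n} = sup_n Q(T^{⊠n})^{1/n}`. -/
noncomputable def asympSubrank {ι1 ι2 ι3 : Type*} [Fintype ι1] [Fintype ι2] [Fintype ι3]
    (T : ι1 → ι2 → ι3 → F) : ℝ :=
  ⨆ m : ℕ, (subrank (kronPow T (m + 1)) : ℝ) ^ ((1 : ℝ) / (m + 1))

/-- First flattening of a tensor. -/
def flattening1 {ι1 ι2 ι3 : Type*} (T : ι1 → ι2 → ι3 → F) : Matrix ι1 (ι2 × ι3) F :=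
  Matrix.of fun i p => T i p.1 p.2

/-- Second flattening of a tensor. -/
def flattening2 {ι1 ι2 ι3 : Type*} (T : ι1 → ι2 → ι3 → F) : Matrix ι2 (ι1 × ι3) F :=
  Matrix.of fun j p => T p.1 j p.2

/-- Third flattening of a tensor. -/
def flattening3 {ι1 ι2 ι3 : Type*} (T : ι1 → ι2 → ι3 → F) : Matrix ι3 (ι1 × ι2) F :=
  Matrix.of fun k p => T p.1 p.2 k

/-- A tensor is concise if all three flattening ranks are maximal. -/
noncomputable def Concise {ι1 ι2 ι3 : Type*} [Fintype ι1] [Fintype ι2] [Fintype ι3]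
    (T : ι1 → ι2 → ι3 → F) : Prop :=
  (flattening1 T).rank = Fintype.card ι1 ∧
  (flattening2 T).rank = Fintype.card ι2 ∧
  (flattening3 T).rank = Fintype.card ι3

/-- A tensor has slice rank one if one of its flattenings has rank one. -/
noncomputable def SliceRankOne {ι1 ι2 ι3 : Type*} [Fintype ι1] [Fintype ι2] [Fintype ι3]
    (T : ι1 → ι2 → ι3 → F) : Prop :=
  (flattening1 T).rank = 1 ∨ (flattening2 T).rank = 1 ∨ (flattening3 T).rank = 1

/-- The slice rank `SR(T)`: the least `r` such that `T` is a sum of `r` slice-rank-one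
tensors. -/
noncomputable def sliceRank {ι1 ι2 ι3 : Type*} [Fintype ι1] [Fintype ι2] [Fintype ι3]
    (T : ι1 → ι2 → ι3 → F) : ℕ :=
  sInf {r : ℕ | ∃ f : Fin r → (ι1 → ι2 → ι3 → F),
    (∀ t, SliceRankOne (f t)) ∧ T = ∑ t, f t}

/-- The liminf-asymptotic slice rank. -/
noncomputable def asympSliceRankInf {ι1 ι2 ι3 : Type*} [Fintype ι1] [Fintype ι2] [Fintype ι3]
    (T : ι1 → ι2 → ι3 → F) : ℝ :=
  Filter.liminf (fun m : ℕ => (sliceRank (kronPow T m) : ℝ) ^ ((1 : ℝ) / m)) Filter.atTop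

/-- The limsup-asymptotic slice rank. -/
noncomputable def asympSliceRankSup {ι1 ι2 ι3 : Type*} [Fintype ι1] [Fintype ι2] [Fintype ι3]
    (T : ι1 → ι2 → ι3 → F) : ℝ :=
  Filter.limsup (fun m : ℕ => (sliceRank (kronPow T m) : ℝ) ^ ((1 : ℝ) / m)) Filter.atTop

/-- The max-rank of a matrix subspace. -/
noncomputable def maxrank {m n : Type*} [Fintype n] (𝒜 : Submodule F (Matrix m n F)) : ℕ :=
  sSup {r : ℕ | ∃ A ∈ 𝒜, A.rank = r}

/-- The min-rank of a matrix subspace: the least rank of a nonzero element. -/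
noncomputable def minrank {m n : Type*} [Fintype n] (𝒜 : Submodule F (Matrix m n F)) : ℕ :=
  sInf {r : ℕ | ∃ A ∈ 𝒜, A ≠ 0 ∧ A.rank = r}

section Slices

variable {n1 n2 n3 : ℕ}

/-- Span of the 3-slices, rows indexed by direction 1, columns by direction 2. -/
def span12 (T : Fin n1 → Fin n2 → Fin n3 → F) : Submodule F (Matrix (Fin n1) (Fin n2) F) :=
  Submodule.span F (Set.range fun k : Fin n3 => Matrix.of fun i j => T i j k)

/-- Span of the 3-slices, rows indexed by direction 2, columns by direction 1. -/
def span21 (T : Fin n1 → Fin n2 → Fin n3 → F) : Submodule F (Matrix (Fin n2) (Fin n1) F) :=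
  Submodule.span F (Set.range fun k : Fin n3 => Matrix.of fun j i => T i j k)

/-- Span of the 2-slices, rows indexed by direction 1, columns by direction 3. -/
def span13 (T : Fin n1 → Fin n2 → Fin n3 → F) : Submodule F (Matrix (Fin n1) (Fin n3) F) :=
  Submodule.span F (Set.range fun j : Fin n2 => Matrix.of fun i k => T i j k)

/-- Span of the 2-slices, rows indexed by direction 3, columns by direction 1. -/
def span31 (T : Fin n1 → Fin n2 → Fin n3 → F) : Submodule F (Matrix (Fin n3) (Fin n1) F) :=
  Submodule.span F (Set.range fun j : Fin n2 => Matrix.of fun k i => T i j k)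

/-- Span of the 1-slices, rows indexed by direction 2, columns by direction 3. -/
def span23 (T : Fin n1 → Fin n2 → Fin n3 → F) : Submodule F (Matrix (Fin n2) (Fin n3) F) :=
  Submodule.span F (Set.range fun i : Fin n1 => Matrix.of fun j k => T i j k)

/-- Span of the 1-slices, rows indexed by direction 3, columns by direction 2. -/
def span32 (T : Fin n1 → Fin n2 → Fin n3 → F) : Submodule F (Matrix (Fin n3) (Fin n2) F) :=
  Submodule.span F (Set.range fun i : Fin n1 => Matrix.of fun k j => T i j k)

/-- `Q_1(T)`: max-rank of the span of the 1-slices. -/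
noncomputable def Q1 (T : Fin n1 → Fin n2 → Fin n3 → F) : ℕ := maxrank (span23 T)

/-- `Q_2(T)`: max-rank of the span of the 2-slices. -/
noncomputable def Q2 (T : Fin n1 → Fin n2 → Fin n3 → F) : ℕ := maxrank (span13 T)

/-- `Q_3(T)`: max-rank of the span of the 3-slices. -/
noncomputable def Q3 (T : Fin n1 → Fin n2 → Fin n3 → F) : ℕ := maxrank (span12 T)

end Slices

/-- `p` is the pivot of the matrix `A`: the lexicographically least position of a
nonzero entry. -/
def IsPivot {n1 n2 : ℕ} (A : Matrix (Fin n1) (Fin n2) F) (p : Fin n1 × Fin n2) : Prop :=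
  A p.1 p.2 ≠ 0 ∧ ∀ q : Fin n1 × Fin n2, A q.1 q.2 ≠ 0 → p.1 < q.1 ∨ (p.1 = q.1 ∧ p.2 ≤ q.2)

/-- The set of pivots of a matrix subspace (equal to the pivots of any basis with
pairwise distinct pivots). -/
def pivotSet {n1 n2 : ℕ} (𝒜 : Submodule F (Matrix (Fin n1) (Fin n2) F)) :
    Set (Fin n1 × Fin n2) :=
  {p | ∃ A ∈ 𝒜, IsPivot A p}

/-- `ρ(𝒜)`: the least `r = |S1| + |S2|` such that the pivots of `𝒜` are covered by the
rows `S1` and columns `S2`. -/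
noncomputable def rho {n1 n2 : ℕ} (𝒜 : Submodule F (Matrix (Fin n1) (Fin n2) F)) : ℕ :=
  sInf {r : ℕ | ∃ (S1 : Finset (Fin n1)) (S2 : Finset (Fin n2)),
    S1.card + S2.card = r ∧ ∀ p ∈ pivotSet 𝒜, p.1 ∈ S1 ∨ p.2 ∈ S2}

/-- The border subrank `Q̲(T)`: the largest `r` such that, over Laurent polynomials
in `ε`, some restriction of `T` equals `⟨r⟩ + ε S_1 + ⋯ + ε^t S_t`. -/
noncomputable def borderSubrank {ι1 ι2 ι3 : Type*} [Fintype ι1] [Fintype ι2] [Fintype ι3]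
    (T : ι1 → ι2 → ι3 → F) : ℕ :=
  sSup {r : ℕ |
    ∃ (A : Fin r → ι1 → LaurentPolynomial F) (B : Fin r → ι2 → LaurentPolynomial F)
      (C : Fin r → ι3 → LaurentPolynomial F) (t : ℕ)
      (S : Fin t → (Fin r → Fin r → Fin r → F)),
      ∀ a b c,
        (∑ i, ∑ j, ∑ k, A a i * B b j * C c k * LaurentPolynomial.C (T i j k)) =
          LaurentPolynomial.C (unitTensor F r a b c) +
            ∑ s : Fin t, LaurentPolynomial.T (((s : ℕ) : ℤ) + 1) *
              LaurentPolynomial.C (S s a b c)}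

/-- The linear map `A ↦ U * A * V` on rectangular matrices. -/
def conjMap {n1 n2 : ℕ} (U : Matrix (Fin n1) (Fin n1) F) (V : Matrix (Fin n2) (Fin n2) F) :
    Matrix (Fin n1) (Fin n2) F →ₗ[F] Matrix (Fin n1) (Fin n2) F where
  toFun A := U * A * V
  map_add' A B := by simp [Matrix.mul_add, Matrix.add_mul]
  map_smul' c A := by simp [Matrix.mul_smul, Matrix.smul_mul]

/-- The principal submatrix `A_{J×J}`, where `J ⊆ [min{n1,n2}]` is encoded by the
map `η`. -/
def restrictJJ {n1 n2 jn : ℕ} (η : Fin jn → Fin (min n1 n2))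
    (A : Matrix (Fin n1) (Fin n2) F) : Matrix (Fin jn) (Fin jn) F :=
  Matrix.of fun p q =>
    A (Fin.castLE (min_le_left n1 n2) (η p)) (Fin.castLE (min_le_right n1 n2) (η q))

/-- An order-three tensor over `F` of arbitrary format. -/
structure Tensor3 (F : Type*) [Field F] where
  n1 : ℕ
  n2 : ℕ
  n3 : ℕ
  coef : Fin n1 → Fin n2 → Fin n3 → F

/-- Two tensors are equivalent if each restricts to the other. -/
def Tensor3.Equivalent (T S : Tensor3 F) : Prop :=
  Restricts T.coef S.coef ∧ Restricts S.coef T.coef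

/-- A rank-one order-`k` tensor: a tensor product of `k` nonzero vectors. -/
def RankOne {k : ℕ} {ι : Fin k → Type*} (T : ((i : Fin k) → ι i) → F) : Prop :=
  ∃ u : (i : Fin k) → (ι i → F), (∀ i, u i ≠ 0) ∧ ∀ v, T v = ∏ i, u i (v i)

/-- The tensor rank of an order-`k` tensor. -/
noncomputable def tensorRank {k : ℕ} {ι : Fin k → Type*} (T : ((i : Fin k) → ι i) → F) : ℕ :=
  sInf {r : ℕ | ∃ f : Fin r → (((i : Fin k) → ι i) → F),
    (∀ t, RankOne (f t)) ∧ T = ∑ t, f t}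

/-- Kronecker power of an order-`k` tensor. -/
def kronPowK {k : ℕ} {ι : Fin k → Type*} (T : ((i : Fin k) → ι i) → F) (m : ℕ) :
    ((i : Fin k) → (Fin m → ι i)) → F :=
  fun v => ∏ s : Fin m, T fun i => v i s

/-- The asymptotic rank `R~(T) = lim_n R(T^{⊠n})^{1/n} = inf_n R(T^{⊠n})^{1/n}`. -/
noncomputable def asympRank {k : ℕ} {ι : Fin k → Type*} (T : ((i : Fin k) → ι i) → F) : ℝ :=
  ⨅ m : ℕ, (tensorRank (kronPowK T (m + 1)) : ℝ) ^ ((1 : ℝ) / (m + 1))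

section LinearAlgebra

open Module

variable {U V E : Type*} [AddCommGroup U] [Module F U] [AddCommGroup V] [Module F V]
  [AddCommGroup E] [Module F E]

/-- Neumann's argument: if `u₀` maximizes the rank of `φ u`, there are as many vectors `v j` as
this rank such that every `u` with `φ u (v j) = 0` for all `j` maps into the range of `φ u₀`. -/
theorem exists_range_le_of_forall_eq_zero [FiniteDimensional F E] (φ : U →ₗ[F] V →ₗ[F] E) :
    ∃ (u₀ : U) (v : Fin (finrank F (LinearMap.range (φ u₀))) → V),
      ∀ u, (∀ j, φ u (v j) = 0) → LinearMap.range (φ u) ≤ LinearMap.range (φ u₀) := by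
  obtain ⟨u₀, hu₀⟩ : ∃ u₀, ∀ u,
      finrank F (LinearMap.range (φ u)) ≤ finrank F (LinearMap.range (φ u₀)) := by
    have hbdd : BddAbove (Set.range fun u => finrank F (LinearMap.range (φ u))) :=
      ⟨finrank F E, by rintro _ ⟨u, rfl⟩; exact Submodule.finrank_le _⟩
    obtain ⟨u₀, h⟩ := Nat.sSup_mem (Set.range_nonempty _) hbdd
    exact ⟨u₀, fun u => (le_csSup hbdd ⟨u, rfl⟩).trans h.ge⟩
  let b := finBasis F (LinearMap.range (φ u₀))
  choose v hv using fun j => LinearMap.mem_range.1 (b j).2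
  refine ⟨u₀, v, fun u hu => ?_⟩
  have hle : LinearMap.range (φ u₀) ≤ LinearMap.range (φ (u₀ + u)) := by
    intro e he
    have h : ((∑ j, b.repr ⟨e, he⟩ j • b j : LinearMap.range (φ u₀)) : E) = e := by
      rw [b.sum_repr]
    rw [Submodule.coe_sum] at h
    refine ⟨∑ j, b.repr ⟨e, he⟩ j • v j, Eq.trans ?_ h⟩
    simp [hv, hu]
  have heq := Submodule.eq_of_le_of_finrank_le hle (hu₀ _)
  rintro _ ⟨w, rfl⟩
  have h : φ u w = φ (u₀ + u) w - φ u₀ w := by simp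
  rw [h]
  refine Submodule.sub_mem _ ?_ ⟨w, rfl⟩
  rw [heq]
  exact ⟨w, rfl⟩

theorem finrank_finsetSup_le {ι : Type*} [FiniteDimensional F E] (s : Finset ι)
    (p : ι → Submodule F E) : finrank F (s.sup p : Submodule F E) ≤ ∑ i ∈ s, finrank F (p i) := by
  classical
  induction s using Finset.induction_on with
  | empty => simp
  | insert i s hi ih =>
    rw [Finset.sup_insert, Finset.sum_insert hi]
    exact (Submodule.finrank_add_le_finrank_add_finrank _ _).trans (by gcongr)

/-- A bilinear map whose partial maps have ranks at most `r` and `s` has values in a space of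
dimension bounded in terms of `r` and `s`. -/
theorem finrank_le_of_bilinear_rank_le [FiniteDimensional F U] [FiniteDimensional F E]
    (φ : U →ₗ[F] V →ₗ[F] E) {r s : ℕ}
    (hr : ∀ u, finrank F (LinearMap.range (φ u)) ≤ r)
    (hs : ∀ v, finrank F (LinearMap.range (φ.flip v)) ≤ s)
    (hspan : ∀ p : Submodule F E, (∀ u v, φ u v ∈ p) → p = ⊤) :
    finrank F E ≤ r + r * s * r := by
  obtain ⟨u₀, v, hv⟩ := exists_range_le_of_forall_eq_zero φ
  let g : U →ₗ[F] (∀ j, LinearMap.range (φ.flip (v j))) :=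
    LinearMap.pi fun j => (φ.flip (v j)).rangeRestrict
  have hg : ∀ u ∈ LinearMap.ker g, ∀ j, φ u (v j) = 0 := fun u hu j => by
    simpa [g] using congrArg Subtype.val (congrFun (LinearMap.mem_ker.1 hu) j)
  obtain ⟨C, hC⟩ := Submodule.exists_isCompl (LinearMap.ker g)
  have hCrank : finrank F C ≤ r * s := by
    have h1 := Submodule.finrank_add_eq_of_isCompl hC
    have h2 := LinearMap.finrank_range_add_finrank_ker g
    have h3 := Submodule.finrank_le (LinearMap.range g)
    rw [Module.finrank_pi_fintype] at h3
    have h4 : ∑ j, finrank F (LinearMap.range (φ.flip (v j))) ≤ r * s := by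
      refine (Finset.sum_le_card_nsmul _ _ s fun j _ => hs _).trans ?_
      simpa using Nat.mul_le_mul_right s (hr u₀)
    omega
  let c := finBasis F C
  let q : Submodule F E := Finset.univ.sup fun i => LinearMap.range (φ (c i))
  have htop : LinearMap.range (φ u₀) ⊔ q = ⊤ := by
    refine hspan _ fun u w => ?_
    obtain ⟨a, ha, d, hd, rfl⟩ := Submodule.mem_sup.1
      (hC.sup_eq_top ▸ Submodule.mem_top : u ∈ LinearMap.ker g ⊔ C)
    rw [map_add, LinearMap.add_apply]
    refine Submodule.add_mem_sup (hv a (hg a ha) ⟨w, rfl⟩) ?_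
    have h := congrArg Subtype.val (c.sum_repr ⟨d, hd⟩)
    simp only [Submodule.coe_sum, Submodule.coe_smul] at h
    rw [← h, map_sum, LinearMap.sum_apply]
    refine Submodule.sum_mem _ fun i _ => ?_
    rw [map_smul, LinearMap.smul_apply]
    refine Submodule.smul_mem _ _ ?_
    exact (Finset.le_sup (f := fun i => LinearMap.range (φ (c i))) (Finset.mem_univ i)) ⟨w, rfl⟩
  have hq : finrank F q ≤ r * s * r := by
    refine (finrank_finsetSup_le _ _).trans
      ((Finset.sum_le_card_nsmul _ _ r fun i _ => hr _).trans ?_)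
    simpa using Nat.mul_le_mul_right r hCrank
  have h := Submodule.finrank_add_le_finrank_add_finrank (LinearMap.range (φ u₀)) q
  rw [htop, finrank_top] at h
  exact h.trans (Nat.add_le_add (hr u₀) hq)

/-- If no nonzero functional composed with the bilinear map `φ` vanishes on the kernel of a linear
map of rank at most `(dim E)²`, then some `φ u` is surjective. -/
theorem exists_surjective_of_bilinear [FiniteDimensional F E] (φ : U →ₗ[F] V →ₗ[F] E)
    (h : ∀ μ : E →ₗ[F] F, μ ≠ 0 → ∀ r ≤ finrank F E, ∀ g : U →ₗ[F] (Fin r → E),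
      ∃ u v, g u = 0 ∧ μ (φ u v) ≠ 0) :
    ∃ u, Function.Surjective (φ u) := by
  obtain ⟨u₀, v, hv⟩ := exists_range_le_of_forall_eq_zero φ
  refine ⟨u₀, LinearMap.range_eq_top.1 ?_⟩
  by_contra hne
  obtain ⟨μ, hμ, hle⟩ := Submodule.exists_le_ker_of_lt_top _ (lt_top_iff_ne_top.2 hne)
  obtain ⟨u, w, hu, hw⟩ := h μ hμ _ (Submodule.finrank_le (LinearMap.range (φ u₀)))
    (LinearMap.pi fun j => φ.flip (v j))
  exact hw (hle (hv u (fun j => by simpa using congrFun hu j) ⟨w, rfl⟩))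

variable {m n : Type*} [Fintype n]

open Matrix in
theorem exists_vecMul_ne_zero_of_finrank_lt_rank [Fintype m] [FiniteDimensional F E]
    (M : Matrix m n F)
    (g : (m → F) →ₗ[F] E) (h : finrank F E < M.rank) : ∃ u, g u = 0 ∧ u ᵥ* M ≠ 0 := by
  by_contra! hcon
  have hle : LinearMap.ker g ≤ LinearMap.ker Mᵀ.mulVecLin := fun u hu => by
    simpa [Matrix.mulVec_transpose] using hcon u hu
  have h1 := LinearMap.finrank_range_add_finrank_ker g
  have h2 := LinearMap.finrank_range_add_finrank_ker Mᵀ.mulVecLin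
  have h3 := Submodule.finrank_mono hle
  have h4 := Submodule.finrank_le (LinearMap.range g)
  rw [← Matrix.rank_transpose, Matrix.rank] at h
  omega

theorem rank_sum_le {ι : Type*} (s : Finset ι) (A : ι → Matrix m n F) :
    (∑ i ∈ s, A i).rank ≤ ∑ i ∈ s, (A i).rank := by
  classical
  induction s using Finset.induction_on with
  | empty => simp
  | insert i s hi ih =>
    rw [Finset.sum_insert hi, Finset.sum_insert hi]
    refine le_trans ?_ (Nat.add_le_add_left ih _)
    unfold Matrix.rank
    rw [Matrix.mulVecLin_add]
    refine (Submodule.finrank_mono ?_).trans (Submodule.finrank_add_le_finrank_add_finrank _ _)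
    rintro _ ⟨w, rfl⟩
    exact Submodule.add_mem_sup ⟨w, rfl⟩ ⟨w, rfl⟩

/-- A linear map between coordinate spaces of rank at least `g` restricts to the identity on `g`
coordinates. -/
theorem exists_restrict_eq_one [Fintype m] (f : (m → F) →ₗ[F] (n → F)) {g : ℕ}
    (hg : g ≤ finrank F (LinearMap.range f)) :
    ∃ (P : Fin g → m → F) (R : Fin g → n → F),
      ∀ x y, ∑ k, R y k * f (P x) k = if x = y then 1 else 0 := by
  classical
  obtain ⟨w, hw⟩ : ∃ w : Fin g → LinearMap.range f, LinearIndependent F w :=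
    ⟨_, (finBasis F (LinearMap.range f)).linearIndependent.comp _ (Fin.castLE_injective hg)⟩
  choose P hP using fun j => LinearMap.mem_range.1 (w j).2
  have hw' : LinearIndependent F fun j => (w j : n → F) :=
    hw.map' (LinearMap.range f).subtype (Submodule.ker_subtype _)
  obtain ⟨q, hq⟩ := LinearMap.exists_leftInverse_of_injective
    (Fintype.linearCombination F fun j => (w j : n → F))
    (LinearMap.ker_eq_bot.2 hw'.fintypeLinearCombination_injective)
  refine ⟨P, fun y k => q (Pi.single k 1) y, fun x y => ?_⟩
  have h1 : q (w x) = Pi.single x 1 := by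
    have := LinearMap.congr_fun hq (Pi.single x 1)
    simpa [Fintype.linearCombination_apply_single] using this
  have h2 : q (f (P x)) y = ∑ k, f (P x) k * q (Pi.single k 1) y := by
    conv_lhs => rw [pi_eq_sum_univ' (f (P x))]
    simp [Finset.sum_apply]
  rw [hP, h1] at h2
  rw [hP]
  simp_rw [mul_comm (q _ y)]
  rw [← h2, Pi.single_apply]
  simp [eq_comm]

end LinearAlgebra

section Tensors

open Module

variable {ι1 ι2 ι3 : Type*}

/-- Cyclic rotation of the three legs of a tensor. -/
def rot (T : ι1 → ι2 → ι3 → F) : ι2 → ι3 → ι1 → F := fun j k i => T i j k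

variable [Fintype ι1] [Fintype ι2] [Fintype ι3]

/-- Some linear combination of the 1-slices of `T` has rank at least `g`, witnessed by a
restriction to the identity matrix. -/
def HasSliceCombRank (T : ι1 → ι2 → ι3 → F) (g : ℕ) : Prop :=
  ∃ (a : ι1 → F) (P : Fin g → ι2 → F) (R : Fin g → ι3 → F), ∀ x y,
    ∑ i, ∑ j, ∑ k, a i * P x j * R y k * T i j k = if x = y then 1 else 0

/-- The bilinear map given by contracting the first two legs of a tensor. -/
def contract (T : ι1 → ι2 → ι3 → F) : (ι1 → F) →ₗ[F] (ι2 → F) →ₗ[F] (ι3 → F) :=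
  LinearMap.mk₂ F (fun a b k => ∑ i, ∑ j, a i * b j * T i j k)
    (fun a a' b => by ext k; simp [add_mul, Finset.sum_add_distrib])
    (fun c a b => by ext k; simp [Finset.mul_sum, mul_assoc])
    (fun a b b' => by ext k; simp [add_mul, mul_add, Finset.sum_add_distrib])
    (fun c a b => by
      ext k
      simp only [Pi.smul_apply, smul_eq_mul, Finset.mul_sum]
      refine Finset.sum_congr rfl fun i _ => Finset.sum_congr rfl fun j _ => by ring)

@[simp]
theorem contract_apply {κ : Type*} (T : ι1 → ι2 → κ → F) (a : ι1 → F) (b : ι2 → F) (k : κ) :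
    contract T a b k = ∑ i, ∑ j, a i * b j * T i j k := rfl

theorem span_eq_top_of_rank_flattening3 (T : ι1 → ι2 → ι3 → F)
    (h : (flattening3 T).rank = Fintype.card ι3) :
    Submodule.span F (Set.range fun p : ι1 × ι2 => T p.1 p.2) = ⊤ := by
  rw [Matrix.rank_eq_finrank_span_cols] at h
  exact Submodule.eq_top_of_finrank_eq (h.trans (finrank_fintype_fun_eq_card F).symm)

theorem hasSliceCombRank_or (T : ι1 → ι2 → ι3 → F)
    (hT : Submodule.span F (Set.range fun p : ι1 × ι2 => T p.1 p.2) = ⊤) {g : ℕ}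
    (hg : g + g * g * g < Fintype.card ι3) :
    HasSliceCombRank T g ∨ HasSliceCombRank (rot T) g := by
  classical
  by_contra! hcon
  have h := finrank_le_of_bilinear_rank_le (contract T) (r := g) (s := g)
    (fun u => by
      by_contra! hu
      obtain ⟨P, R, h⟩ := exists_restrict_eq_one _ hu.le
      refine hcon.1 ⟨u, P, R, fun x y => ?_⟩
      rw [← h]
      simp only [contract_apply, Finset.mul_sum]
      rw [Finset.sum_comm_cycle]
      refine Finset.sum_congr rfl fun k _ => Finset.sum_congr rfl fun i _ =>
        Finset.sum_congr rfl fun j _ => by ring)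
    (fun u => by
      by_contra! hu
      obtain ⟨P, R, h⟩ := exists_restrict_eq_one _ hu.le
      refine hcon.2 ⟨u, R, P, fun x y => ?_⟩
      simp only [eq_comm (a := x)]
      rw [← h]
      simp only [LinearMap.flip_apply, contract_apply, Finset.mul_sum]
      rw [Finset.sum_comm]
      refine Finset.sum_congr rfl fun k _ => ?_
      rw [Finset.sum_comm]
      refine Finset.sum_congr rfl fun i _ => Finset.sum_congr rfl fun j _ => by simp only [rot]; ring)
    (fun p hp => by
      rw [eq_top_iff, ← hT, Submodule.span_le]
      rintro _ ⟨⟨i, j⟩, rfl⟩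
      suffices h : T i j = contract T (Pi.single i 1) (Pi.single j 1) from
        (congrArg (· ∈ p) h).mpr (hp _ _)
      ext k
      rw [contract_apply, Finset.sum_eq_single i, Finset.sum_eq_single j] <;>
        simp +contextual [Pi.single_apply])
  rw [finrank_fintype_fun_eq_card] at h
  omega

theorem le_card_of_factor_one {κ : Type*} [Fintype κ] {r : ℕ} (A : Fin r → κ → F)
    (B : κ → Fin r → F) (h : ∀ x y, ∑ k, A x k * B k y = if x = y then 1 else 0) :
    r ≤ Fintype.card κ := by
  have h1 : Matrix.of A * Matrix.of B = (1 : Matrix (Fin r) (Fin r) F) := by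
    ext x y
    simp [Matrix.mul_apply, h, Matrix.one_apply]
  calc r = (1 : Matrix (Fin r) (Fin r) F).rank := by simp [Matrix.rank_one]
    _ ≤ (Matrix.of A).rank := by rw [← h1]; exact Matrix.rank_mul_le_left _ _
    _ ≤ _ := Matrix.rank_le_card_width _

theorem HasSliceCombRank.le_card2 {T : ι1 → ι2 → ι3 → F} {g : ℕ} (h : HasSliceCombRank T g) :
    g ≤ Fintype.card ι2 := by
  obtain ⟨a, P, R, h⟩ := h
  refine le_card_of_factor_one P (fun j y => ∑ i, ∑ k, a i * R y k * T i j k) fun x y => ?_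
  rw [← h, Finset.sum_comm]
  simp only [Finset.mul_sum]
  refine Finset.sum_congr rfl fun i _ => Finset.sum_congr rfl fun j _ =>
    Finset.sum_congr rfl fun k _ => by ring

theorem HasSliceCombRank.le_card3 {T : ι1 → ι2 → ι3 → F} {g : ℕ} (h : HasSliceCombRank T g) :
    g ≤ Fintype.card ι3 := by
  obtain ⟨a, P, R, h⟩ := h
  refine le_card_of_factor_one R (fun k x => ∑ i, ∑ j, a i * P x j * T i j k) fun x y => ?_
  simp only [eq_comm (a := x)]
  rw [← h, ← Finset.sum_comm_cycle]
  simp only [Finset.mul_sum]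
  rw [← Finset.sum_comm_cycle]
  rw [← Finset.sum_comm_cycle]
  refine Finset.sum_congr rfl fun i _ => Finset.sum_congr rfl fun j _ =>
    Finset.sum_congr rfl fun k _ => by ring

theorem Restricts.le_card {T : ι1 → ι2 → ι3 → F} {r : ℕ} (h : Restricts T (unitTensor F r)) :
    r ≤ Fintype.card ι1 := by
  obtain ⟨L1, L2, L3, h⟩ := h
  refine le_card_of_factor_one L1 (fun i y => ∑ j, ∑ k, L2 y j * L3 y k * T i j k) fun x y => ?_
  have := h x y y
  simp only [unitTensor, and_true] at this
  rw [this]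
  simp only [Finset.mul_sum]
  refine Finset.sum_congr rfl fun i _ => Finset.sum_congr rfl fun j _ =>
    Finset.sum_congr rfl fun k _ => by ring

theorem bddAbove_setOf_restricts (T : ι1 → ι2 → ι3 → F) :
    BddAbove {r : ℕ | Restricts T (unitTensor F r)} := ⟨_, fun _ h => Restricts.le_card h⟩

theorem Restricts.of_rot {T : ι1 → ι2 → ι3 → F} {r : ℕ}
    (h : Restricts (rot T) (unitTensor F r)) : Restricts T (unitTensor F r) := by
  obtain ⟨L1, L2, L3, h⟩ := h
  refine ⟨L3, L1, L2, fun a b c => ?_⟩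
  have : unitTensor F r a b c = unitTensor F r b c a := by
    simp only [unitTensor]
    congr 1
    exact propext ⟨by rintro ⟨rfl, rfl⟩; simp, by rintro ⟨rfl, rfl⟩; simp⟩
  rw [this, h, Finset.sum_comm_cycle]
  refine Finset.sum_congr rfl fun i _ => Finset.sum_congr rfl fun j _ =>
    Finset.sum_congr rfl fun k _ => by simp only [rot]; ring

theorem Restricts.asymp_pow_le {T : ι1 → ι2 → ι3 → F} {m r : ℕ} (hm : m ≠ 0)
    (h : Restricts (kronPow T m) (unitTensor F r)) : (r : ℝ) ≤ asympSubrank T ^ m := by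
  classical
  obtain ⟨m, rfl⟩ := Nat.exists_eq_succ_of_ne_zero hm
  have hbdd : BddAbove (Set.range fun m : ℕ =>
      (subrank (kronPow T (m + 1)) : ℝ) ^ ((1 : ℝ) / (m + 1))) := by
    refine ⟨Fintype.card ι1, ?_⟩
    rintro _ ⟨m, rfl⟩
    have h1 : subrank (kronPow T (m + 1)) ≤ Fintype.card ι1 ^ (m + 1) := by
      refine csSup_le' fun r hr => ?_
      simpa using Restricts.le_card hr
    have h2 : (subrank (kronPow T (m + 1)) : ℝ) ≤ (Fintype.card ι1 : ℝ) ^ (m + 1) := by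
      exact_mod_cast h1
    refine (Real.rpow_le_rpow (by positivity) h2 (by positivity)).trans ?_
    have h3 := Real.pow_rpow_inv_natCast (Nat.cast_nonneg (α := ℝ) (Fintype.card ι1))
      (Nat.succ_ne_zero m)
    simpa using h3.le
  have h1 : (r : ℝ) ≤ subrank (kronPow T (m + 1)) := by
    exact_mod_cast le_csSup (bddAbove_setOf_restricts _) h
  have h2 := le_ciSup hbdd m
  have h3 := Real.rpow_inv_natCast_pow (Nat.cast_nonneg (α := ℝ) (subrank (kronPow T (m + 1))))
    (Nat.succ_ne_zero m)
  calc (r : ℝ) ≤ subrank (kronPow T (m + 1)) := h1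
    _ = ((subrank (kronPow T (m + 1)) : ℝ) ^ ((1 : ℝ) / (m + 1))) ^ (m + 1) := by
      simpa using h3.symm
    _ ≤ _ := pow_le_pow_left₀ (by positivity) h2 _

theorem asympSubrank_nonneg (T : ι1 → ι2 → ι3 → F) : 0 ≤ asympSubrank T :=
  Real.iSup_nonneg fun _ => by positivity

theorem sum_pi_prod_eq {m : ℕ} (h : Fin m → ι1 → ι2 → ι3 → F) :
    ∑ x : Fin m → ι1, ∑ y : Fin m → ι2, ∑ z : Fin m → ι3, ∏ s, h s (x s) (y s) (z s) =
      ∏ s, ∑ i, ∑ j, ∑ k, h s i j k := by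
  classical
  simp_rw [Finset.prod_univ_sum, Fintype.piFinset_univ]

theorem restricts_kronPow_two {T : ι1 → ι2 → ι3 → F} {g : ℕ} (h1 : HasSliceCombRank T g)
    (h2 : HasSliceCombRank (rot T) g) : Restricts (kronPow T 2) (unitTensor F g) := by
  obtain ⟨a, P, R, h1⟩ := h1
  obtain ⟨b, P', R', h2⟩ := h2
  refine ⟨fun x i => a (i 0) * R' x (i 1), fun y j => P y (j 0) * b (j 1),
    fun z k => R z (k 0) * P' z (k 1), fun x y z => ?_⟩
  have h := sum_pi_prod_eq (m := 2) (fun s i j k =>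
    (if s = 0 then a i * P y j * R z k else R' x i * b j * P' z k) * T i j k)
  have e1 : (∑ i, ∑ j, ∑ k, R' x i * b j * P' z k * T i j k) = if z = x then 1 else 0 := by
    rw [← h2]
    refine Eq.trans ?_ Finset.sum_comm_cycle.symm
    refine Finset.sum_congr rfl fun i _ => Finset.sum_congr rfl fun j _ =>
      Finset.sum_congr rfl fun k _ => by simp only [rot]; ring
  simp only [Fin.prod_univ_two, if_true, one_ne_zero, if_false, Fin.isValue, h1, e1] at h
  have e2 : unitTensor F g x y z = (if y = z then 1 else 0) * if z = x then 1 else 0 := by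
    simp only [unitTensor]
    grind
  rw [e2, ← h]
  refine Finset.sum_congr rfl fun i _ => Finset.sum_congr rfl fun j _ =>
    Finset.sum_congr rfl fun k _ => ?_
  simp only [kronPow, Fin.prod_univ_two]
  ring

theorem restricts_unitTensor_of_lt_rank {d : ℕ} (T : ι1 → ι2 → Fin d → F)
    (h : ∀ c : Fin d → F, c ≠ 0 → d ^ 4 < (Matrix.of fun i j => ∑ k, c k * T i j k).rank) :
    Restricts T (unitTensor F d) := by
  classical
  let Φ : (Fin d → ι1 → F) →ₗ[F] (ι2 → F) →ₗ[F] (Fin d → Fin d → F) :=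
    LinearMap.mk₂ F (fun u v a => contract T (u a) v)
      (fun u u' v => by ext a : 1; simp only [Pi.add_apply, map_add, LinearMap.add_apply])
      (fun c u v => by ext a : 1; simp only [Pi.smul_apply, map_smul, LinearMap.smul_apply])
      (fun u v v' => by ext a : 1; simp only [Pi.add_apply, map_add])
      (fun c u v => by ext a : 1; simp only [Pi.smul_apply, map_smul])
  obtain ⟨u, hu⟩ := exists_surjective_of_bilinear Φ (by
    intro μ hμ r hr g
    obtain ⟨a, ha⟩ : ∃ a, μ ∘ₗ LinearMap.single F (fun _ : Fin d => Fin d → F) a ≠ 0 := by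
      by_contra! hcon
      exact hμ (LinearMap.pi_ext' fun a => by rw [hcon a, LinearMap.zero_comp])
    let c : Fin d → F := fun k => μ (Pi.single a (Pi.single k 1))
    have hμc : ∀ e : Fin d → F, μ (Pi.single a e) = ∑ k, c k * e k := fun e => by
      have he : (Pi.single a e : Fin d → Fin d → F) = ∑ k, e k • Pi.single a (Pi.single k 1) := by
        conv_lhs => rw [pi_eq_sum_univ' e]
        rw [← LinearMap.single_apply (R := F), map_sum]
        refine Finset.sum_congr rfl fun k _ => ?_
        exact map_smul (LinearMap.single F (fun _ : Fin d => Fin d → F) a) (e k) (Pi.single k 1)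
      rw [he, map_sum]
      exact Finset.sum_congr rfl fun k _ => by rw [map_smul, smul_eq_mul, mul_comm]
    have hc : c ≠ 0 := fun hc => ha (LinearMap.ext fun e => by
      simpa [hc] using hμc e)
    obtain ⟨w, hgw, hw⟩ := exists_vecMul_ne_zero_of_finrank_lt_rank _
      (g ∘ₗ LinearMap.single F (fun _ : Fin d => ι1 → F) a)
      (lt_of_le_of_lt (by
        have h1 : finrank F (Fin d → Fin d → F) = d * d := by
          simp [Module.finrank_pi_fintype]
        rw [h1] at hr
        rw [Module.finrank_pi_fintype]
        simp only [h1, Finset.sum_const, Finset.card_univ, Fintype.card_fin, smul_eq_mul]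
        calc r * (d * d) ≤ d * d * (d * d) := Nat.mul_le_mul_right _ hr
          _ = d ^ 4 := by ring) (h c hc))
    obtain ⟨j, hj⟩ := Function.ne_iff.1 hw
    refine ⟨Pi.single a w, Pi.single j 1, hgw, fun h0 => hj ?_⟩
    have hΦ : Φ (Pi.single a w) (Pi.single j 1) = Pi.single a (contract T w (Pi.single j 1)) := by
      ext b : 1
      by_cases hb : b = a
      · subst hb; simp [Φ]
      · simp [Φ, hb]
    rw [hΦ, hμc] at h0
    rw [Pi.zero_apply, ← h0]
    simp only [Matrix.vecMul, dotProduct, Matrix.of_apply, contract_apply, Finset.mul_sum,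
      Pi.single_apply, mul_ite, mul_one, mul_zero, ite_mul, zero_mul, Finset.sum_ite_eq',
      Finset.mem_univ, if_true]
    rw [Finset.sum_comm]
    exact Finset.sum_congr rfl fun k _ => Finset.sum_congr rfl fun i _ => by ring)
  choose v hv using fun b : Fin d => hu fun a k => unitTensor F d a b k
  refine ⟨u, v, fun c k => if k = c then 1 else 0, fun a b c => ?_⟩
  rw [← congrFun (congrFun (hv b) a) c]
  simp [Φ]

theorem restricts_of_restricts_reindex {κ : Type*} [Fintype κ] {r : ℕ} (T : ι1 → ι2 → ι3 → F)
    (e : κ → ι3) (h : Restricts (fun i j k => T i j (e k)) (unitTensor F r)) :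
    Restricts T (unitTensor F r) := by
  classical
  obtain ⟨L1, L2, L3, h⟩ := h
  refine ⟨L1, L2, fun c k => ∑ l, if e l = k then L3 c l else 0, fun a b c => ?_⟩
  rw [h]
  refine Finset.sum_congr rfl fun i _ => Finset.sum_congr rfl fun j _ => ?_
  simp only [Finset.mul_sum, Finset.sum_mul]
  rw [Finset.sum_comm]
  refine Finset.sum_congr rfl fun l _ => ?_
  simp

theorem restricts_unitTensor_of_lt_rank_on (T : ι1 → ι2 → ι3 → F) (K : Finset ι3)
    (h : ∀ c : ι3 → F, c ≠ 0 → (∀ k ∉ K, c k = 0) →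
      K.card ^ 4 < (Matrix.of fun i j => ∑ k, c k * T i j k).rank) :
    Restricts T (unitTensor F K.card) := by
  classical
  refine restricts_of_restricts_reindex T (fun k => (K.equivFin.symm k : ι3))
    (restricts_unitTensor_of_lt_rank _ fun c hc => ?_)
  let c' : ι3 → F := fun k => if h : k ∈ K then c (K.equivFin ⟨k, h⟩) else 0
  have hsum : ∀ f : ι3 → F, ∑ k, c k * f (K.equivFin.symm k) = ∑ k, c' k * f k := fun f => by
    rw [← Finset.sum_subset (Finset.subset_univ K) (fun k _ hk => by simp [c', hk]),
      ← Finset.sum_coe_sort K, ← Equiv.sum_comp K.equivFin.symm]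
    exact Finset.sum_congr rfl fun k _ => by simp [c']
  simp only [hsum]
  refine h c' (fun h0 => hc (funext fun k => ?_)) fun k hk => by simp [c', hk]
  simpa [c'] using congrFun h0 (K.equivFin.symm k)

theorem exists_interpolation {α β : Type*} [DecidableEq ι3] (T : α → β → ι3 → F)
    (hT : Submodule.span F (Set.range fun p : α × β => T p.1 p.2) = ⊤) :
    ∃ (pos : Fin (Fintype.card ι3) → α × β) (D : ι3 → Fin (Fintype.card ι3) → F),
      ∀ l k, ∑ q, D l q * T (pos q).1 (pos q).2 k = if l = k then 1 else 0 := by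
  have hrank : finrank F (Submodule.span F (Set.range fun p : α × β => T p.1 p.2)) =
      Fintype.card ι3 := by
    rw [hT, finrank_top, finrank_fintype_fun_eq_card]
  obtain ⟨f, hf, hspan, -⟩ := Submodule.exists_fun_fin_finrank_span_eq F
    (Set.range fun p : α × β => T p.1 p.2)
  replace hspan := hspan.trans hT
  choose pos hpos using hf
  have hD : ∀ l : ι3, ∃ D : Fin _ → F, ∑ q, D q • f q = Pi.single l 1 := fun l =>
    (Submodule.mem_span_range_iff_exists_fun F).1 (by rw [hspan]; exact Submodule.mem_top)
  choose D hD using hD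
  refine ⟨pos ∘ Fin.cast hrank.symm, fun l q => D l (Fin.cast hrank.symm q), fun l k => ?_⟩
  have h := congrFun (hD l) k
  rw [Pi.single_apply] at h
  simp only [eq_comm (a := l)]
  rw [← h, Finset.sum_apply, ← Equiv.sum_comp (finCongr hrank.symm)]
  refine Finset.sum_congr rfl fun q _ => ?_
  rw [Pi.smul_apply, smul_eq_mul, ← hpos]
  rfl

open Classical in
theorem pow_le_card_pow_mul_rank (T : ι1 → ι2 → ι3 → F)
    (hT : Submodule.span F (Set.range fun p : ι1 × ι2 => T p.1 p.2) = ⊤) (k₀ : ι3) {R : ℕ}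
    (hR : 0 < R) (P : Fin R → ι1 → F) (Q : Fin R → ι2 → F)
    (hPQ : ∀ x y, ∑ i, ∑ j, P x i * Q y j * T i j k₀ = if x = y then 1 else 0) {m p : ℕ}
    (c : (Fin m → ι3) → F) (hc : c ≠ 0)
    (hcp : ∀ k, c k ≠ 0 → p ≤ (Finset.univ.filter fun s => k s = k₀).card) :
    R ^ p ≤ Fintype.card ι3 ^ m *
      (Matrix.of fun x y => ∑ k, c k * kronPow T m x y k).rank := by
  obtain ⟨pos, D, hD⟩ := exists_interpolation T hT
  have hcard : 0 < Fintype.card ι3 := Fintype.card_pos_iff.2 ⟨k₀⟩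
  obtain ⟨l, hl, hmin⟩ := Finset.exists_min_image (Finset.univ.filter fun k => c k ≠ 0)
    (fun k => (Finset.univ.filter fun s => k s = k₀).card) (by
      obtain ⟨k, hk⟩ := Function.ne_iff.1 hc
      exact ⟨k, by simpa using hk⟩)
  replace hl : c l ≠ 0 := by simpa using hl
  let S : Finset (Fin m) := Finset.univ.filter fun s => l s = k₀
  have hmin' : ∀ k, c k ≠ 0 → (∀ s ∉ S, k s = l s) → k = l := fun k hk hkl => by
    have hsub : (Finset.univ.filter fun s => k s = k₀) ⊆ S := fun s hs => by
      by_contra hsS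
      have h1 := hkl s hsS
      simp only [Finset.mem_filter, Finset.mem_univ, true_and, S] at hs hsS
      exact hsS (h1 ▸ hs)
    have heq := Finset.eq_of_subset_of_card_le hsub (hmin k (by simpa using hk))
    funext s
    by_cases hs : s ∈ S
    · have h1 : k s = k₀ := by rw [← heq] at hs; simpa using hs
      have h2 : l s = k₀ := by simpa [S] using hs
      rw [h1, h2]
    · exact hkl s hs
  let q₀ : Fin (Fintype.card ι3) := ⟨0, hcard⟩
  let w : Fin m → Fin (Fintype.card ι3) → F := fun s q =>
    if s ∈ S then (if q = q₀ then 1 else 0) else D (l s) q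
  let A : Fin m → Fin (Fintype.card ι3) → (S → Fin R) → ι1 → F := fun s q z i =>
    if h : s ∈ S then P (z ⟨s, h⟩) i else if i = (pos q).1 then 1 else 0
  let B : Fin m → Fin (Fintype.card ι3) → (S → Fin R) → ι2 → F := fun s q z j =>
    if h : s ∈ S then Q (z ⟨s, h⟩) j else if j = (pos q).2 then 1 else 0
  let X : Matrix (Fin m → ι1) (Fin m → ι2) F := Matrix.of fun x y => ∑ k, c k * kronPow T m x y k
  let t : Fin m → ι3 → (S → Fin R) → (S → Fin R) → F := fun s k z z' =>
    ∑ q, ∑ i, ∑ j, w s q * A s q z i * B s q z' j * T i j k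
  have ht : ∀ s ∉ S, ∀ k z z', t s k z z' = if l s = k then 1 else 0 := fun s hs k z z' => by
    simp only [t, w, A, B, hs, if_false, dite_false]
    rw [← hD]
    simp
  have ht' : ∀ s (hs : s ∈ S), ∀ z z', t s k₀ z z' =
      if z ⟨s, hs⟩ = z' ⟨s, hs⟩ then 1 else 0 := fun s hs z z' => by
    simp only [t, w, A, B, hs, if_true, dite_true]
    rw [← hPQ, Finset.sum_eq_single q₀ (fun q _ hq => by simp [hq]) (by simp)]
    simp
  have hprod : ∀ z z', (∑ k : Fin m → ι3, c k * ∏ s, t s (k s) z z') =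
      if z = z' then c l else 0 := fun z z' => by
    rw [Finset.sum_eq_single l]
    · by_cases hz : z = z'
      · rw [if_pos hz, Finset.prod_eq_one, mul_one]
        intro s _
        by_cases hs : s ∈ S
        · have h2 : l s = k₀ := by simpa [S] using hs
          rw [h2, ht' s hs, if_pos (by rw [hz])]
        · rw [ht s hs, if_pos rfl]
      · obtain ⟨⟨s, hs⟩, hne⟩ := Function.ne_iff.1 hz
        have h2 : l s = k₀ := by simpa [S] using hs
        rw [if_neg hz, Finset.prod_eq_zero (Finset.mem_univ s), mul_zero]
        rw [h2, ht' s hs, if_neg hne]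
    · intro k _ hk
      by_cases hck : c k = 0
      · rw [hck, zero_mul]
      · obtain ⟨s, hs, hne⟩ : ∃ s, s ∉ S ∧ k s ≠ l s := by
          by_contra! hcon
          exact hk (hmin' k hck hcon)
        rw [Finset.prod_eq_zero (Finset.mem_univ s), mul_zero]
        rw [ht s hs, if_neg (Ne.symm hne)]
    · simp
  let A' : (Fin m → Fin (Fintype.card ι3)) → Matrix (S → Fin R) (Fin m → ι1) F := fun q =>
    Matrix.of fun z x => (c l)⁻¹ * ∏ s, (w s (q s) * A s (q s) z (x s))
  let B' : (Fin m → Fin (Fintype.card ι3)) → Matrix (Fin m → ι2) (S → Fin R) F := fun q =>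
    Matrix.of fun y z => ∏ s, B s (q s) z (y s)
  have hone : ∑ q, A' q * X * B' q = 1 := by
    ext z z'
    have h1 : (1 : Matrix (S → Fin R) (S → Fin R) F) z z' =
        (c l)⁻¹ * ∑ k : Fin m → ι3, c k * ∏ s, t s (k s) z z' := by
      rw [hprod, Matrix.one_apply]
      split_ifs <;> simp [hl]
    rw [h1, Matrix.sum_apply]
    simp only [t, ← sum_pi_prod_eq]
    simp only [Matrix.mul_apply, A', B', X, Matrix.of_apply, Finset.mul_sum, Finset.sum_mul]
    rw [Finset.sum_comm (γ := Fin m → ι3)]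
    refine Finset.sum_congr rfl fun q _ => ?_
    rw [Finset.sum_comm (γ := Fin m → ι3), Finset.sum_comm (γ := Fin m → ι2)]
    refine Finset.sum_congr rfl fun x _ => ?_
    rw [Finset.sum_comm (γ := Fin m → ι3)]
    refine Finset.sum_congr rfl fun y _ => Finset.sum_congr rfl fun k _ => ?_
    simp only [kronPow, Finset.prod_mul_distrib]
    ring
  calc R ^ p ≤ R ^ S.card := Nat.pow_le_pow_right hR (hcp l hl)
    _ = (1 : Matrix (S → Fin R) (S → Fin R) F).rank := by simp [Matrix.rank_one]
    _ ≤ ∑ q, (A' q * X * B' q).rank := by rw [← hone]; exact rank_sum_le _ _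
    _ ≤ ∑ q : Fin m → Fin (Fintype.card ι3), X.rank := Finset.sum_le_sum fun q _ =>
      (Matrix.rank_mul_le_left _ _).trans (Matrix.rank_mul_le_right _ _)
    _ = _ := by simp [X]


open Classical in
theorem pow_le_mul_card_filter {κ : Type*} [Fintype κ] (k₀ : κ) (p : ℕ) :
    Fintype.card κ ^ (Fintype.card κ * p) ≤ Fintype.card κ *
      (Finset.univ.filter fun k : Fin (Fintype.card κ * p) → κ =>
        p ≤ (Finset.univ.filter fun s => k s = k₀).card).card := by
  let K : κ → Finset (Fin (Fintype.card κ * p) → κ) := fun j =>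
    Finset.univ.filter fun k => p ≤ (Finset.univ.filter fun s => k s = j).card
  have hcover : (Finset.univ : Finset (Fin (Fintype.card κ * p) → κ)) ⊆
      Finset.univ.biUnion K := fun k _ => by
    obtain ⟨j, -, hj⟩ := Finset.exists_le_card_fiber_of_mul_le_card_of_maps_to
      (s := Finset.univ) (t := Finset.univ) (f := k) (n := p) (fun _ _ => Finset.mem_univ _)
      ⟨k₀, Finset.mem_univ _⟩ (by simp)
    exact Finset.mem_biUnion.2 ⟨j, Finset.mem_univ _, by simpa [K] using hj⟩
  have hle : ∀ j, (K j).card ≤ (K k₀).card := fun j =>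
    Finset.card_le_card_of_injOn (fun k s => Equiv.swap j k₀ (k s))
      (fun k hk => by
        simp only [K, Finset.coe_filter, Finset.mem_univ, true_and, Set.mem_ofPred_eq] at hk ⊢
        refine hk.trans (Finset.card_le_card fun s hs => ?_)
        simp only [Finset.mem_filter, Finset.mem_univ, true_and] at hs ⊢
        rw [hs, Equiv.swap_apply_left])
      fun k _ k' _ h => funext fun s => (Equiv.swap j k₀).injective (congrFun h s)
  calc Fintype.card κ ^ (Fintype.card κ * p)
      = (Finset.univ : Finset (Fin (Fintype.card κ * p) → κ)).card := by simp
    _ ≤ ∑ j, (K j).card := (Finset.card_le_card hcover).trans Finset.card_biUnion_le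
    _ ≤ ∑ _j : κ, (K k₀).card := Finset.sum_le_sum fun j _ => hle j
    _ = _ := by simp [K]

theorem card_le_asympSubrank_of_slice (T : ι1 → ι2 → ι3 → F)
    (hT : Submodule.span F (Set.range fun p : ι1 × ι2 => T p.1 p.2) = ⊤) (k₀ : ι3) {R : ℕ}
    (hR : Fintype.card ι3 ^ (5 * Fintype.card ι3) < R) (P : Fin R → ι1 → F) (Q : Fin R → ι2 → F)
    (hPQ : ∀ x y, ∑ i, ∑ j, P x i * Q y j * T i j k₀ = if x = y then 1 else 0) :
    (Fintype.card ι3 : ℝ) ≤ asympSubrank T := by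
  classical
  have hcard : 0 < Fintype.card ι3 := Fintype.card_pos_iff.2 ⟨k₀⟩
  have hpow : ∀ p ≠ 0, (Fintype.card ι3 : ℝ) ^ (Fintype.card ι3 * p) ≤
      Fintype.card ι3 * asympSubrank T ^ (Fintype.card ι3 * p) := fun p hp => by
    have hK := pow_le_mul_card_filter k₀ p
    set K := Finset.univ.filter fun k : Fin (Fintype.card ι3 * p) → ι3 =>
        p ≤ (Finset.univ.filter fun s => k s = k₀).card with hKdef
    have hres := restricts_unitTensor_of_lt_rank_on (kronPow T (Fintype.card ι3 * p)) K
      fun e he heK => by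
        have h1 := pow_le_card_pow_mul_rank T hT k₀ (Nat.zero_lt_of_lt hR) P Q hPQ e he
          (p := p) fun k hk => by
            by_contra hcon
            refine hk (heK k ?_)
            simpa [hKdef] using hcon
        by_contra! hrank
        have hKle : K.card ≤ Fintype.card ι3 ^ (Fintype.card ι3 * p) :=
          (Finset.card_le_univ K).trans (by simp)
        refine lt_irrefl (R ^ p) ?_
        calc R ^ p ≤ _ := h1
          _ ≤ Fintype.card ι3 ^ (Fintype.card ι3 * p) *
              (Fintype.card ι3 ^ (Fintype.card ι3 * p)) ^ 4 :=
            Nat.mul_le_mul_left _ (hrank.trans (Nat.pow_le_pow_left hKle 4))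
          _ = (Fintype.card ι3 ^ (5 * Fintype.card ι3)) ^ p := by
            rw [← pow_mul, ← pow_add, ← pow_mul]; congr 1; ring
          _ < R ^ p := Nat.pow_lt_pow_left hR hp
    have h2 := Restricts.asymp_pow_le (mul_ne_zero hcard.ne' hp) hres
    calc (Fintype.card ι3 : ℝ) ^ (Fintype.card ι3 * p) ≤ Fintype.card ι3 * K.card := by
          exact_mod_cast hK
      _ ≤ _ := mul_le_mul_of_nonneg_left h2 (Nat.cast_nonneg _)
  by_contra! hlt
  have hcR : (0 : ℝ) < Fintype.card ι3 := by exact_mod_cast hcard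
  have hA := asympSubrank_nonneg T
  have hdiv : asympSubrank T / Fintype.card ι3 < 1 := (div_lt_one hcR).2 hlt
  have hdiv0 : 0 ≤ asympSubrank T / Fintype.card ι3 := div_nonneg hA hcR.le
  obtain ⟨n, hn⟩ := exists_pow_lt_of_lt_one (inv_pos.2 hcR) hdiv
  have h3 : (asympSubrank T / Fintype.card ι3) ^ (Fintype.card ι3 * (n + 1)) <
      (Fintype.card ι3 : ℝ)⁻¹ :=
    (pow_le_pow_of_le_one hdiv0 hdiv.le (by nlinarith)).trans_lt hn
  have h4 := hpow (n + 1) n.succ_ne_zero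
  rw [div_pow, div_lt_iff₀ (by positivity), inv_mul_eq_div, lt_div_iff₀ hcR] at h3
  linarith [mul_comm (asympSubrank T ^ (Fintype.card ι3 * (n + 1))) (Fintype.card ι3 : ℝ)]

/-- A bound on the slice-combination rank in the small direction forces the asymptotic subrank
to be maximal. -/
theorem card_le_asympSubrank_of_hasSliceCombRank {G : ℕ} (T : ι1 → ι2 → ι3 → F)
    (hT : Submodule.span F (Set.range fun p : ι1 × ι2 => T p.1 p.2) = ⊤)
    (hG : Fintype.card ι3 * (Fintype.card ι3 ^ (5 * Fintype.card ι3) + 1) ≤ G) (hG0 : 0 < G)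
    (h : HasSliceCombRank (rot (rot T)) G) :
    (Fintype.card ι3 : ℝ) ≤ asympSubrank T := by
  obtain ⟨a, P, R, hPR⟩ := h
  obtain ⟨k₀, hk₀⟩ : ∃ k₀, Fintype.card ι3 ^ (5 * Fintype.card ι3) + 1 ≤
      (Matrix.of fun j i => T i j k₀).rank := by
    by_contra! hcon
    have hone : ∑ k, a k • (Matrix.of P * (Matrix.of fun i j => T i j k) * (Matrix.of R).transpose)
        = (1 : Matrix (Fin G) (Fin G) F) := by
      ext x y
      rw [Matrix.sum_apply, Matrix.one_apply, ← hPR]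
      refine Finset.sum_congr rfl fun k _ => ?_
      simp only [Matrix.smul_apply, Matrix.mul_apply, Matrix.of_apply, Matrix.transpose_apply,
        smul_eq_mul, Finset.mul_sum, Finset.sum_mul, rot]
      rw [Finset.sum_comm]
      exact Finset.sum_congr rfl fun i _ => Finset.sum_congr rfl fun j _ => by ring
    have hle : G ≤ ∑ k, (Matrix.of fun j i => T i j k).rank := by
      calc G = (1 : Matrix (Fin G) (Fin G) F).rank := by simp
        _ ≤ _ := hone ▸ rank_sum_le _ _
        _ ≤ _ := Finset.sum_le_sum fun k _ => ?_
      rw [← Matrix.smul_mul, ← Matrix.smul_mul]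
      refine (Matrix.rank_mul_le_left _ _).trans ((Matrix.rank_mul_le_right _ _).trans ?_)
      rw [← Matrix.rank_transpose]
      rfl
    rcases isEmpty_or_nonempty ι3 with hemp | hne
    · simp at hle; omega
    · have : ∑ k, (Matrix.of fun j i => T i j k).rank < ∑ _k : ι3,
          (Fintype.card ι3 ^ (5 * Fintype.card ι3) + 1) :=
        Finset.sum_lt_sum_of_nonempty Finset.univ_nonempty fun k _ => hcon k
      simp only [Finset.sum_const, Finset.card_univ, smul_eq_mul] at this
      omega
  obtain ⟨P', Q', hPQ⟩ := exists_restrict_eq_one (Matrix.of fun j i => T i j k₀).mulVecLin hk₀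
  refine card_le_asympSubrank_of_slice T hT k₀ (Nat.lt_succ_self _) P' Q' fun x y => ?_
  rw [← hPQ, Finset.sum_comm]
  refine Finset.sum_congr rfl fun j _ => ?_
  simp only [Matrix.mulVecLin_apply, Matrix.mulVec, dotProduct, Matrix.of_apply, Finset.mul_sum]
  exact Finset.sum_congr rfl fun i _ => by ring

theorem asympSubrank_rot_le (T : ι1 → ι2 → ι3 → F) : asympSubrank (rot T) ≤ asympSubrank T := by
  refine ciSup_le fun m => ?_
  have h : Restricts (kronPow (rot T) (m + 1)) (unitTensor F (subrank (kronPow (rot T) (m + 1)))) :=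
    Nat.sSup_mem (s := {r | Restricts (kronPow (rot T) (m + 1)) (unitTensor F r)})
      ⟨0, fun a => a.elim0, fun a => a.elim0, fun a => a.elim0, fun a => a.elim0⟩
      (bddAbove_setOf_restricts _)
  have h2 := Restricts.asymp_pow_le m.succ_ne_zero (Restricts.of_rot (T := kronPow T (m + 1)) h)
  calc _ ≤ (asympSubrank T ^ (m + 1)) ^ ((1 : ℝ) / (m + 1)) :=
        Real.rpow_le_rpow (Nat.cast_nonneg _) h2 (by positivity)
    _ = asympSubrank T := by
      have := Real.pow_rpow_inv_natCast (asympSubrank_nonneg T) m.succ_ne_zero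
      simpa using this

/-- The vectors `T i j ·` span the third leg. -/
def SpansThird (T : ι1 → ι2 → ι3 → F) : Prop :=
  Submodule.span F (Set.range fun p : ι1 × ι2 => T p.1 p.2) = ⊤

theorem Concise.spansThird {T : ι1 → ι2 → ι3 → F} (h : Concise T) :
    SpansThird T ∧ SpansThird (rot T) ∧ SpansThird (rot (rot T)) := by
  refine ⟨span_eq_top_of_rank_flattening3 _ h.2.2, span_eq_top_of_rank_flattening3 _ h.1,
    span_eq_top_of_rank_flattening3 _ ?_⟩
  rw [← h.2.1]
  exact Matrix.rank_submatrix (flattening2 T) (Equiv.refl _) (Equiv.prodComm _ _)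

theorem HasSliceCombRank.le_asympSubrank_sq {T : ι1 → ι2 → ι3 → F} {g : ℕ}
    (h : HasSliceCombRank T g) (h' : HasSliceCombRank (rot T) g) :
    (g : ℝ) ≤ asympSubrank T ^ 2 :=
  Restricts.asymp_pow_le two_ne_zero (restricts_kronPow_two h h')

/-- If all three dimensions are large, then so is the asymptotic subrank. -/
theorem le_asympSubrank_sq {T : ι1 → ι2 → ι3 → F} (h0 : SpansThird T) (h1 : SpansThird (rot T))
    (h2 : SpansThird (rot (rot T))) {g : ℕ} (hg1 : g + g * g * g < Fintype.card ι1)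
    (hg2 : g + g * g * g < Fintype.card ι2) (hg3 : g + g * g * g < Fintype.card ι3) :
    (g : ℝ) ≤ asympSubrank T ^ 2 := by
  have r1 := asympSubrank_rot_le T
  have r2 := (asympSubrank_rot_le (rot T)).trans r1
  have o0 := hasSliceCombRank_or T h0 hg3
  have o1 := hasSliceCombRank_or (rot T) h1 hg1
  have o2 := hasSliceCombRank_or (rot (rot T)) h2 hg2
  rcases o0 with s0 | s1
  · rcases o1 with s1 | s2
    · exact s0.le_asympSubrank_sq s1
    · exact (s2.le_asympSubrank_sq s0).trans (pow_le_pow_left₀ (asympSubrank_nonneg _) r2 2)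
  · rcases o2 with s2 | s0
    · exact (s1.le_asympSubrank_sq s2).trans (pow_le_pow_left₀ (asympSubrank_nonneg _) r1 2)
    · exact s0.le_asympSubrank_sq s1

/-- For tensors with third dimension `c`, once another dimension exceeds this bound the
asymptotic subrank is at least `c`. -/
def dimBound (c : ℕ) : ℕ :=
  let G := c * (c ^ (5 * c) + 1) + c + 1
  G + G * G * G

theorem card_le_asympSubrank {T : ι1 → ι2 → ι3 → F} (h0 : SpansThird T)
    (h1 : SpansThird (rot T)) (h2 : SpansThird (rot (rot T)))
    (h : dimBound (Fintype.card ι3) < Fintype.card ι1 ∨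
      dimBound (Fintype.card ι3) < Fintype.card ι2) :
    (Fintype.card ι3 : ℝ) ≤ asympSubrank T := by
  refine card_le_asympSubrank_of_hasSliceCombRank
    (G := Fintype.card ι3 * (Fintype.card ι3 ^ (5 * Fintype.card ι3) + 1) + Fintype.card ι3 + 1)
    T h0 (by omega) (by omega) ?_
  rcases h with h | h
  · rcases hasSliceCombRank_or (rot T) h1 h with h' | h'
    · have := h'.le_card2
      omega
    · exact h'
  · rcases hasSliceCombRank_or (rot (rot T)) h2 h with h' | h'
    · exact h'
    · have := HasSliceCombRank.le_card3 (T := T) h'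
      omega

/-- Concise tensors of bounded asymptotic subrank have bounded format unless their asymptotic
subrank is at least the minimal dimension. -/
theorem exists_dim_bound (B : ℕ) : ∃ M : ℕ, ∀ {ι1 ι2 ι3 : Type} [Fintype ι1] [Fintype ι2]
    [Fintype ι3] (T : ι1 → ι2 → ι3 → F), Concise T → asympSubrank T ≤ B →
    (Fintype.card ι1 ≤ M ∧ Fintype.card ι2 ≤ M ∧ Fintype.card ι3 ≤ M) ∨
    ((min (min (Fintype.card ι1) (Fintype.card ι2)) (Fintype.card ι3) : ℕ) : ℝ) ≤
      asympSubrank T := by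
  let g := B ^ 2 + 1
  let N := g + g * g * g
  have hM : ∀ c ≤ N, dimBound c ≤ ∑ c ∈ Finset.range (N + 1), dimBound c := fun c hc =>
    Finset.single_le_sum (f := dimBound) (fun _ _ => Nat.zero_le _)
      (Finset.mem_range.2 (Nat.lt_succ_of_le hc))
  refine ⟨N + ∑ c ∈ Finset.range (N + 1), dimBound c, fun {ι1 ι2 ι3} _ _ _ T hT hB => ?_⟩
  obtain ⟨h0, h1, h2⟩ := hT.spansThird
  have r1 := asympSubrank_rot_le T
  have r2 := (asympSubrank_rot_le (rot T)).trans r1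
  by_contra! hcon
  obtain ⟨hbig, hmin⟩ := hcon
  have n1 : N < Fintype.card ι1 := by
    by_contra! hle
    have hM1 := hM _ hle
    have := card_le_asympSubrank (T := rot T) h1 h2 h0 (by omega)
    exact hmin.not_ge ((Nat.cast_le.2 (by omega)).trans (this.trans r1))
  have n2 : N < Fintype.card ι2 := by
    by_contra! hle
    have hM1 := hM _ hle
    have := card_le_asympSubrank (T := rot (rot T)) h2 h0 h1 (by omega)
    exact hmin.not_ge ((Nat.cast_le.2 (by omega)).trans (this.trans r2))
  have n3 : N < Fintype.card ι3 := by
    by_contra! hle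
    have hM1 := hM _ hle
    have := card_le_asympSubrank h0 h1 h2 (by omega)
    exact hmin.not_ge ((Nat.cast_le.2 (by omega)).trans this)
  have hsq := (le_asympSubrank_sq h0 h1 h2 n1 n2 n3).trans
    (pow_le_pow_left₀ (asympSubrank_nonneg T) hB 2)
  have : g ≤ B ^ 2 := by exact_mod_cast hsq
  omega

end Tensors

/-- General discreteness theorem: if `𝒞` is a class of order-three
tensors over `F` closed under passing to concise equivalent representatives, and
`f : 𝒞 → ℝ_{≥0}` is invariant under equivalence, lower bounded by the asymptotic
subrank, takes finitely many values on every fixed format, and is upper bounded by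
the minimal dimension, then the set of values of `f` on `𝒞` has no accumulation
points. -/
theorem values_no_accumulation (F : Type*) [Field F]
    (𝒞 : Set (Tensor3 F)) (f : Tensor3 F → ℝ)
    (hconc : ∀ T ∈ 𝒞, ∃ S ∈ 𝒞, Concise S.coef ∧ S.Equivalent T)
    (hnonneg : ∀ T ∈ 𝒞, 0 ≤ f T)
    (hequiv : ∀ S ∈ 𝒞, ∀ T ∈ 𝒞, S.Equivalent T → f S = f T)
    (hlb : ∀ T ∈ 𝒞, asympSubrank T.coef ≤ f T)
    (hfin : ∀ n1 n2 n3 : ℕ,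
      (f '' {T | T ∈ 𝒞 ∧ T.n1 = n1 ∧ T.n2 = n2 ∧ T.n3 = n3}).Finite)
    (hub : ∀ T ∈ 𝒞, f T ≤ ((min (min T.n1 T.n2) T.n3 : ℕ) : ℝ)) :
    ∀ x : ℝ, ¬ AccPt x (Filter.principal (f '' 𝒞)) := by
  intro x hx
  obtain ⟨B, hB⟩ := exists_nat_gt x
  refine (?_ : ((Set.Iio (B : ℝ)) ∩ f '' 𝒞).Infinite) ?_
  · refine Set.Infinite.of_accPt (x := x) ?_
    rw [accPt_iff_nhds] at hx ⊢
    intro U hU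
    obtain ⟨y, ⟨hyU, hy⟩, hne⟩ := hx _ (Filter.inter_mem hU (Iio_mem_nhds hB))
    exact ⟨y, ⟨hyU.1, hyU.2, hy⟩, hne⟩
  obtain ⟨M, hM⟩ := exists_dim_bound (F := F) B
  have hfinite : ((⋃ n1 ∈ Set.Iic M, ⋃ n2 ∈ Set.Iic M, ⋃ n3 ∈ Set.Iic M,
      f '' {T | T ∈ 𝒞 ∧ T.n1 = n1 ∧ T.n2 = n2 ∧ T.n3 = n3}) ∪
      (Nat.cast : ℕ → ℝ) '' Set.Iio B).Finite := by
    refine Set.Finite.union ?_ ((Set.finite_Iio B).image _)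
    exact (Set.finite_Iic M).biUnion fun n1 _ => (Set.finite_Iic M).biUnion fun n2 _ =>
      (Set.finite_Iic M).biUnion fun n3 _ => hfin n1 n2 n3
  refine hfinite.subset ?_
  rintro _ ⟨hlt, T, hT, rfl⟩
  obtain ⟨S, hS, hSc, hST⟩ := hconc T hT
  rw [← hequiv S hS T hT hST] at hlt ⊢
  rcases hM S.coef hSc ((hlb S hS).trans (le_of_lt hlt)) with ⟨b1, b2, b3⟩ | hmin
  · left
    simp only [Fintype.card_fin] at b1 b2 b3
    simp only [Set.mem_iUnion]
    exact ⟨S.n1, b1, S.n2, b2, S.n3, b3, S, ⟨hS, rfl, rfl, rfl⟩, rfl⟩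
  · right
    simp only [Fintype.card_fin] at hmin
    have heq := le_antisymm (hub S hS) (hmin.trans (hlb S hS))
    refine ⟨_, ?_, heq.symm⟩
    rw [Set.mem_Iio, heq, Nat.cast_lt] at hlt
    exact hlt

end Paper
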